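/- Let m ≥ 1 be an integer, let x ∈ [0,∞)^m with Σ_{i=1}^m x_i = 1, let S₁,…,S_m be i.i.d. random variables with the exponential distribution of mean 1, set B = Σ_{i=1}^m x_i·S_i, and let Z be a standard normal random variable independent of the S_i. Then for every a ≥ 0 and b > 0: P[ a·(B − 1) ≤ Z − b ] ≥ Q(b); equivalently, the function a ↦ E[ Q( a·B − a + b ) ] is bounded below on [0,∞) by its value Q(b) at a = 0. -/

import Mathlib

open MeasureTheory ProbabilityTheory

/-- The Gaussian Q-function `Q(y) = P[Z > y]` for `Z` standard normal. -/
noncomputable def gaussianQ (y : ℝ) : ℝ :=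
  (gaussianReal 0 1 (Set.Ioi y)).toReal

lemma aux_exp_eq : expMeasure 1 =
    (volume.restrict (Set.Ioi (0:ℝ))).withDensity (fun s => ENNReal.ofReal (Real.exp (-s))) := by
  have h : expMeasure 1 = volume.withDensity (exponentialPDF 1) := rfl
  rw [h, ← withDensity_indicator measurableSet_Ioi]
  apply withDensity_congr_ae
  filter_upwards [(measure_singleton (μ := volume) (0:ℝ) : _) |> compl_mem_ae_iff.mpr] with s hs
  have hs : s ≠ 0 := hs
  rw [exponentialPDF_eq]
  by_cases h : 0 < s
  · simp [h, h.le]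
  · have : ¬ 0 ≤ s := fun h' => h (lt_of_le_of_ne h' (Ne.symm hs))
    simp [h, this]

lemma aux_integral_exp {F : Type*} [NormedAddCommGroup F] [NormedSpace ℝ F] (f : ℝ → F) :
    ∫ s, f s ∂(expMeasure 1) = ∫ s in Set.Ioi (0:ℝ), Real.exp (-s) • f s := by
  rw [aux_exp_eq, integral_withDensity_eq_integral_toReal_smul (by fun_prop) (by simp)]
  simp [ENNReal.toReal_ofReal (Real.exp_nonneg _)]

lemma aux_charfun (c : ℝ) :
    ∫ s, Complex.exp (-(c * s) * Complex.I) ∂(expMeasure 1) = 1 / (1 + c * Complex.I) := by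
  rw [aux_integral_exp]
  have := integral_exp_mul_complex_Ioi (a := -(1 + c * Complex.I)) (by simp) 0
  simp only [Complex.ofReal_zero, mul_zero, Complex.exp_zero, neg_div_neg_eq] at this
  rw [← this]
  congr 1
  ext s
  rw [Complex.real_smul, Complex.ofReal_exp, ← Complex.exp_add]
  congr 1
  push_cast
  ring

lemma aux_integrable : Integrable (fun s : ℝ => s) (expMeasure 1) := by
  rw [aux_exp_eq, integrable_withDensity_iff (by fun_prop) (by simp)]
  have := Real.GammaIntegral_convergent (s := 2) (by norm_num)
  refine (integrableOn_congr_fun ?_ measurableSet_Ioi).mp this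
  intro s hs
  norm_num [ENNReal.toReal_ofReal (Real.exp_nonneg _)]
  ring

lemma aux_K (y : ℝ) : ∫ u in (0:ℝ)..y, Real.exp (-u^2/2) =
    ∫ t, y * Real.sinc (t * y) ∂(gaussianReal 0 1) := by
  have h1 : ∀ u : ℝ, ∫ t, Real.cos (t * u) ∂(gaussianReal 0 1) = Real.exp (-u^2/2) := by
    intro u
    have h := charFun_gaussianReal (μ := 0) (v := 1) u
    rw [charFun_apply_real] at h
    have h2 := congrArg Complex.re h
    have : Integrable (fun t : ℝ => Complex.exp (u * t * Complex.I)) (gaussianReal 0 1) := by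
      refine Integrable.of_bound (C := 1) (by fun_prop) (ae_of_all _ fun t => ?_)
      have := Complex.norm_exp_ofReal_mul_I (u * t)
      push_cast at this
      exact this.le
    rw [← Complex.reCLM_apply, ← ContinuousLinearMap.integral_comp_comm _ this] at h2
    have e : ∀ t : ℝ, Complex.reCLM (Complex.exp (u * t * Complex.I)) = Real.cos (t * u) := by
      intro t
      have := Complex.exp_ofReal_mul_I_re (u * t)
      push_cast at this
      rw [Complex.reCLM_apply, this, mul_comm]
    simp only [e] at h2
    rw [h2]
    have : (u * ((0:ℝ):ℂ) * Complex.I - ((1:NNReal):ℝ) * u^2/2 : ℂ) = ((-u^2/2 : ℝ) : ℂ) := by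
      push_cast; ring
    rw [this, Complex.exp_ofReal_re]
  simp_rw [← h1]
  rw [intervalIntegral_integral_swap]
  · congr 1
    ext t
    by_cases ht : t = 0
    · simp [ht]
    by_cases hy : y = 0
    · simp [hy]
    rw [Real.sinc_of_ne_zero (mul_ne_zero ht hy)]
    rw [intervalIntegral.integral_comp_mul_left (fun x => Real.cos x) ht]
    simp
    field_simp
  · have : IsFiniteMeasure (volume.restrict (Set.uIoc 0 y)) :=
      ⟨by simp [Set.uIoc]⟩
    refine Integrable.of_bound (C := 1) ?_ (ae_of_all _ fun t => ?_)
    · apply Continuous.aestronglyMeasurable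
      simp only [Function.uncurry_def]
      fun_prop
    · simpa [Function.uncurry_def] using Real.abs_cos_le_one _

lemma aux_arctan_le {u : ℝ} (hu : 0 ≤ u) : Real.arctan u ≤ u := by
  have := Real.le_tan (Real.arctan_nonneg.mpr hu) (Real.arctan_lt_pi_div_two u)
  rwa [Real.tan_arctan] at this

lemma aux_le_arctan {u : ℝ} (hu : 0 ≤ u) : u - Real.arctan u ≤ u^3 := by
  have h1 := Real.sin_le (Real.arctan_nonneg.mpr hu)
  rw [Real.sin_arctan] at h1
  have h2 : √(1 + u^2) ≤ 1 + u^2 := by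
    rw [Real.sqrt_le_left (by positivity)]
    nlinarith [sq_nonneg (u^2), sq_nonneg u]
  have h3 : u - u^3 ≤ u / √(1 + u^2) := by
    rw [le_div_iff₀ (by positivity)]
    by_cases h : 1 ≤ u
    · have : u - u^3 ≤ 0 := by nlinarith [sq_nonneg (u-1), mul_nonneg hu (sub_nonneg.mpr h)]
      have h4 := mul_nonneg (neg_nonneg.mpr this) (Real.sqrt_nonneg (1+u^2))
      linarith
    · have : 0 ≤ u - u^3 := by
        have : u^2 ≤ 1 := by nlinarith
        nlinarith
      calc _ ≤ (u - u^3) * (1 + u^2) := mul_le_mul_of_nonneg_left h2 this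
        _ = u - u^5 := by ring
        _ ≤ u := by have : 0 ≤ u^5 := by positivity
                    linarith
  linarith

noncomputable def auxTheta {m : ℕ} (A : Fin m → ℝ) (t : ℝ) : ℝ :=
  ∑ j, (A j * t - Real.arctan (A j * t))

noncomputable def auxR {m : ℕ} (A : Fin m → ℝ) (t : ℝ) : ℝ :=
  ∏ j, √(1 + (A j * t)^2)

noncomputable def auxE {m : ℕ} (A : Fin m → ℝ) (t : ℝ) : ℝ :=
  (t^2 * Real.exp (t^2/2)) * ∑ j, (A j)^3 * (auxR A t * (t / (1 + (A j * t)^2)))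

noncomputable def auxG {m : ℕ} (A : Fin m → ℝ) (t : ℝ) : ℝ :=
  Real.exp (-t^2/2) * (Real.sin (auxTheta A t) / (t * auxR A t))

lemma auxR_one_le {m : ℕ} (A : Fin m → ℝ) (t : ℝ) : 1 ≤ auxR A t := by
  unfold auxR
  apply Finset.one_le_prod
  intro j _
  rw [Real.one_le_sqrt]
  nlinarith [sq_nonneg (A j * t)]

lemma auxTheta_abs {m : ℕ} (A : Fin m → ℝ) (hA : ∀ j, 0 ≤ A j) (t : ℝ) (ht : 0 ≤ t) :
    0 ≤ auxTheta A t ∧ auxTheta A t ≤ (∑ j, A j) * t := by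
  unfold auxTheta
  constructor
  · apply Finset.sum_nonneg
    intro j _
    have := aux_arctan_le (mul_nonneg (hA j) ht)
    linarith
  · rw [Finset.sum_mul]
    apply Finset.sum_le_sum
    intro j _
    have := Real.arctan_nonneg.mpr (mul_nonneg (hA j) ht)
    linarith

lemma auxTheta_cube {m : ℕ} (A : Fin m → ℝ) (hA : ∀ j, 0 ≤ A j) (t : ℝ) (ht : 0 ≤ t) :
    auxTheta A t ≤ (∑ j, (A j)^3) * t^3 := by
  unfold auxTheta
  rw [Finset.sum_mul]
  apply Finset.sum_le_sum
  intro j _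
  rw [← mul_pow]
  exact aux_le_arctan (mul_nonneg (hA j) ht)

lemma auxTheta_neg {m : ℕ} (A : Fin m → ℝ) (t : ℝ) : auxTheta A (-t) = - auxTheta A t := by
  unfold auxTheta
  rw [← Finset.sum_neg_distrib]
  congr 1
  ext j
  rw [mul_neg, Real.arctan_neg]
  ring

lemma auxG_neg {m : ℕ} (A : Fin m → ℝ) (t : ℝ) : auxG A (-t) = auxG A t := by
  unfold auxG
  rw [auxTheta_neg, Real.sin_neg]
  have : auxR A (-t) = auxR A t := by simp [auxR]
  rw [this, neg_sq, neg_mul, neg_div_neg_eq]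

lemma auxTheta_deriv {m : ℕ} (A : Fin m → ℝ) (t : ℝ) :
    HasDerivAt (auxTheta A) (∑ j, (A j - A j / (1 + (A j * t)^2))) t := by
  unfold auxTheta
  apply HasDerivAt.fun_sum
  intro j _
  have h : HasDerivAt (fun t => A j * t) (A j) t := by
    simpa using (hasDerivAt_id t).const_mul (A j)
  have h2 := h.fun_sub h.arctan
  rwa [one_div, inv_mul_eq_div] at h2

lemma auxE_diff {m : ℕ} (A : Fin m → ℝ) (t : ℝ) : DifferentiableAt ℝ (auxE A) t := by
  have h : ∀ j, 1 + (A j * t)^2 ≠ 0 := fun j => by positivity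
  have hR : DifferentiableAt ℝ (auxR A) t := by
    unfold auxR
    apply DifferentiableAt.fun_finsetProd
    intro j _
    exact DifferentiableAt.sqrt (by fun_prop) (h j)
  unfold auxE
  apply DifferentiableAt.mul (by fun_prop)
  apply DifferentiableAt.fun_sum
  intro j _
  apply DifferentiableAt.const_mul
  apply hR.mul
  exact DifferentiableAt.div (by fun_prop) (by fun_prop) (h j)

lemma auxE_mono {m : ℕ} (A : Fin m → ℝ) (hA : ∀ j, 0 ≤ A j) :
    MonotoneOn (auxE A) (Set.Ici 0) := by
  intro s hs t ht hst
  have hs : 0 ≤ s := hs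
  have ht : 0 ≤ t := ht
  have key : ∀ (j : Fin m) (r : ℝ), auxR A r * (r / (1 + (A j * r)^2)) =
      (r / √(1 + (A j * r)^2)) * ∏ k ∈ Finset.univ.erase j, √(1 + (A k * r)^2) := by
    intro j r
    unfold auxR
    rw [← Finset.mul_prod_erase _ _ (Finset.mem_univ j)]
    have hp : 0 < √(1 + (A j * r)^2) := by positivity
    have h2 : 1 + (A j * r)^2 = √(1 + (A j * r)^2) * √(1 + (A j * r)^2) :=
      (Real.mul_self_sqrt (by positivity)).symm
    generalize √(1 + (A j * r)^2) = q at *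
    generalize ∏ k ∈ Finset.univ.erase j, √(1 + (A k * r)^2) = p
    rw [h2]
    field_simp
  unfold auxE
  simp_rw [key]
  have hex : s^2 * Real.exp (s^2/2) ≤ t^2 * Real.exp (t^2/2) := by gcongr
  apply mul_le_mul hex _ _ (by positivity)
  · apply Finset.sum_le_sum
    intro j _
    apply mul_le_mul_of_nonneg_left _ (pow_nonneg (hA j) 3)
    apply mul_le_mul
    · rw [div_le_div_iff₀ (by positivity) (by positivity)]
      apply le_of_sq_le_sq _ (by positivity)
      rw [mul_pow s, mul_pow t, Real.sq_sqrt (by positivity), Real.sq_sqrt (by positivity)]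
      have : s^2 ≤ t^2 := by gcongr
      nlinarith
    · apply Finset.prod_le_prod
      · intros; positivity
      · intro k _
        have := hA k
        gcongr
    · apply Finset.prod_nonneg
      intros; positivity
    · positivity
  · apply Finset.sum_nonneg
    intro j _
    have := hA j
    have : 0 ≤ ∏ k ∈ Finset.univ.erase j, √(1 + (A k * s)^2) := Finset.prod_nonneg (by intros; positivity)
    positivity

lemma auxE_lower {m : ℕ} (A : Fin m → ℝ) (hA : ∀ j, 0 ≤ A j) (j : Fin m) (t : ℝ) (ht : 0 ≤ t) :
    t^2 * ((A j)^3 * (t / (1 + (A j * t)^2))) ≤ auxE A t := by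
  unfold auxE
  have hR := auxR_one_le A t
  have h1 : ∀ k, 0 ≤ (A k)^3 * (auxR A t * (t / (1 + (A k * t)^2))) := by
    intro k
    have := hA k
    positivity
  have h2 := Finset.single_le_sum (fun k _ => h1 k) (Finset.mem_univ j)
  have h3 : 1 ≤ Real.exp (t^2/2) := Real.one_le_exp (by positivity)
  have h4 : (A j)^3 * (t / (1 + (A j * t)^2)) ≤ (A j)^3 * (auxR A t * (t / (1 + (A j * t)^2))) := by
    have := hA j
    apply mul_le_mul_of_nonneg_left _ (by positivity)
    apply le_mul_of_one_le_left (by positivity) hR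
  have h5 := Finset.sum_nonneg (fun k (_ : k ∈ Finset.univ) => h1 k)
  rw [mul_assoc]
  apply mul_le_mul_of_nonneg_left _ (sq_nonneg t)
  calc _ ≤ _ := h4
    _ ≤ _ := h2
    _ ≤ _ := le_mul_of_one_le_left h5 h3

lemma auxG_eq {m : ℕ} (A : Fin m → ℝ) (t : ℝ) (ht : 0 < t) (hE : auxE A t ≠ 0) :
    auxG A t = Real.sin (auxTheta A t) * (∑ j, (A j - A j / (1 + (A j * t)^2))) / auxE A t := by
  have hR : 0 < auxR A t := lt_of_lt_of_le one_pos (auxR_one_le A t)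
  have h : auxE A t = Real.exp (t^2/2) * (auxR A t * t * (∑ j, (A j - A j / (1 + (A j * t)^2)))) := by
    unfold auxE
    rw [mul_comm (t^2), mul_assoc]
    congr 1
    rw [Finset.mul_sum]
    rw [Finset.mul_sum]
    congr 1
    ext j
    have : 1 + (A j * t)^2 ≠ 0 := by positivity
    field_simp
    ring
  have h0 : (∑ j, (A j - A j / (1 + (A j * t)^2))) ≠ 0 := by
    intro h0
    apply hE
    rw [h, h0]; simp
  rw [h]
  unfold auxG
  rw [neg_div, Real.exp_neg]
  have := Real.exp_pos (t^2/2)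
  generalize (∑ j, (A j - A j / (1 + (A j * t)^2))) = q at *
  field_simp

lemma auxG_meas {m : ℕ} (A : Fin m → ℝ) : Measurable (auxG A) := by
  unfold auxG auxTheta auxR
  fun_prop

lemma auxG_bound {m : ℕ} (A : Fin m → ℝ) (hA : ∀ j, 0 ≤ A j) (t : ℝ) (ht : 0 ≤ t) :
    |auxG A t| ≤ ∑ j, A j := by
  have hS : 0 ≤ ∑ j, A j := Finset.sum_nonneg fun j _ => hA j
  rcases ht.eq_or_lt with h | h
  · subst h
    simpa [auxG] using hS
  have hR := auxR_one_le A t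
  unfold auxG
  have h1 : Real.exp (-t^2/2) ≤ 1 := Real.exp_le_one_iff.mpr (by nlinarith [sq_nonneg t])
  obtain ⟨h2, h3⟩ := auxTheta_abs A hA t ht
  have h4 : |Real.sin (auxTheta A t)| ≤ (∑ j, A j) * t :=
    (Real.abs_sin_le_abs).trans (by rwa [abs_of_nonneg h2])
  rw [abs_mul, abs_of_pos (Real.exp_pos _), abs_div, abs_of_pos (by positivity : 0 < t * auxR A t)]
  have h5 : |Real.sin (auxTheta A t)| / (t * auxR A t) ≤ ∑ j, A j := by
    rw [div_le_iff₀ (by positivity)]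
    have : (∑ j, A j) * t ≤ (∑ j, A j) * (t * auxR A t) := by
      apply mul_le_mul_of_nonneg_left _ hS
      exact le_mul_of_one_le_right ht hR
    linarith
  calc _ ≤ 1 * _ := mul_le_mul_of_nonneg_right h1 (by positivity)
    _ ≤ _ := by rw [one_mul]; exact h5

lemma auxG_intervalIntegrable {m : ℕ} (A : Fin m → ℝ) (hA : ∀ j, 0 ≤ A j) (T : ℝ) (hT : 0 ≤ T) :
    IntervalIntegrable (auxG A) volume 0 T := by
  rw [intervalIntegrable_iff_integrableOn_Ioc_of_le hT]
  refine Integrable.of_bound (C := ∑ j, A j) (auxG_meas A).aestronglyMeasurable ?_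
  filter_upwards [ae_restrict_mem measurableSet_Ioc] with t ht
  exact auxG_bound A hA t ht.1.le

lemma auxG_contAt {m : ℕ} (A : Fin m → ℝ) (t : ℝ) (ht : t ≠ 0) :
    ContinuousAt (auxG A) t := by
  have hR := auxR_one_le A t
  have h1 : Continuous (auxR A) := by unfold auxR; fun_prop
  have h2 : Continuous (auxTheta A) := by unfold auxTheta; fun_prop
  unfold auxG
  apply ContinuousAt.mul (by fun_prop)
  apply ContinuousAt.div (by fun_prop) (by fun_prop)
  positivity

lemma aux_core {m : ℕ} (A : Fin m → ℝ) (hA : ∀ j, 0 ≤ A j) (j₀ : Fin m) (hj : 0 < A j₀)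
    (T : ℝ) (hT : 0 < T) : 0 ≤ ∫ t in (0:ℝ)..T, auxG A t := by
  have hEpos : ∀ t, 0 < t → 0 < auxE A t := fun t ht =>
    lt_of_lt_of_le (by positivity) (auxE_lower A hA j₀ t ht.le)
  set H : ℝ → ℝ := fun t => (1 - Real.cos (auxTheta A t)) / auxE A t with hH
  have hE' : ∀ t, 0 < t → 0 ≤ deriv (auxE A) t := by
    intro t ht
    have h1 := (auxE_mono A hA).derivWithin_nonneg (x := t)
    rwa [derivWithin_of_mem_nhds (Ici_mem_nhds ht)] at h1
  have hHd : ∀ t, 0 < t → HasDerivAt H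
      ((Real.sin (auxTheta A t) * (∑ j, (A j - A j / (1 + (A j * t)^2))) * auxE A t
        - (1 - Real.cos (auxTheta A t)) * deriv (auxE A) t) / (auxE A t)^2) t := by
    intro t ht
    have h1 := ((auxTheta_deriv A t).cos.const_sub 1).div (auxE_diff A t).hasDerivAt (hEpos t ht).ne'
    refine h1.congr_deriv ?_
    ring
  have hmono : MonotoneOn (fun T => (∫ t in (0:ℝ)..T, auxG A t) - H T) (Set.Ioi 0) := by
    have hD : ∀ t, 0 < t → HasDerivAt (fun T => (∫ t in (0:ℝ)..T, auxG A t) - H T)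
        (auxG A t - ((Real.sin (auxTheta A t) * (∑ j, (A j - A j / (1 + (A j * t)^2))) * auxE A t
        - (1 - Real.cos (auxTheta A t)) * deriv (auxE A) t) / (auxE A t)^2)) t := by
      intro t ht
      refine HasDerivAt.sub ?_ (hHd t ht)
      exact intervalIntegral.integral_hasDerivAt_right (auxG_intervalIntegrable A hA t ht.le)
        ((auxG_meas A).stronglyMeasurable.stronglyMeasurableAtFilter) (auxG_contAt A t ht.ne')
    apply monotoneOn_of_deriv_nonneg (convex_Ioi 0)
    · intro t ht
      exact (hD t ht).continuousAt.continuousWithinAt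
    · intro t ht
      rw [interior_Ioi] at ht
      exact (hD t ht).differentiableAt.differentiableWithinAt
    · intro t ht
      rw [interior_Ioi] at ht
      have ht : 0 < t := ht
      rw [(hD t ht).deriv, auxG_eq A t ht (hEpos t ht).ne']
      have hp := hEpos t ht
      have hc := Real.cos_le_one (auxTheta A t)
      have hd := hE' t ht
      have : 0 ≤ (1 - Real.cos (auxTheta A t)) * deriv (auxE A) t / (auxE A t)^2 := by
        have : 0 ≤ 1 - Real.cos (auxTheta A t) := by linarith
        positivity
      convert this using 1
      generalize (∑ j, (A j - A j / (1 + (A j * t)^2))) = q at *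
      field_simp
      ring
  have hlim : Filter.Tendsto (fun T => (∫ t in (0:ℝ)..T, auxG A t) - H T)
      (nhdsWithin 0 (Set.Ioi 0)) (nhds 0) := by
    have hS : 0 ≤ ∑ j, A j := Finset.sum_nonneg fun j _ => hA j
    set c := (∑ j, A j) + (∑ j, (A j)^3)^2 * (1 + (A j₀)^2) / (2 * (A j₀)^3) with hc
    apply squeeze_zero_norm' (a := fun t => c * t)
    · have : Set.Ioo (0:ℝ) 1 ∈ nhdsWithin (0:ℝ) (Set.Ioi 0) := Ioo_mem_nhdsGT one_pos
      filter_upwards [this] with t ht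
      have h1 : ‖∫ t in (0:ℝ)..t, auxG A t‖ ≤ (∑ j, A j) * |t - 0| := by
        apply intervalIntegral.norm_integral_le_of_norm_le_const
        intro s hs
        rw [Set.uIoc_of_le ht.1.le] at hs
        exact auxG_bound A hA s hs.1.le
      rw [sub_zero, abs_of_pos ht.1] at h1
      have h2 : ‖H t‖ ≤ (∑ j, (A j)^3)^2 * (1 + (A j₀)^2) / (2 * (A j₀)^3) * t := by
        have ht0 := ht.1
        have hp := hEpos t ht.1
        have hcos := Real.cos_le_one (auxTheta A t)
        have hcos2 := Real.one_sub_sq_div_two_le_cos (x := auxTheta A t)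
        obtain ⟨h3, _⟩ := auxTheta_abs A hA t ht.1.le
        have h4 := auxTheta_cube A hA t ht.1.le
        have h5 : (auxTheta A t)^2 ≤ ((∑ j, (A j)^3) * t^3)^2 := by gcongr
        have h6 := auxE_lower A hA j₀ t ht.1.le
        have h7 : t^2 * ((A j₀)^3 * (t / (1 + (A j₀)^2))) ≤ auxE A t := by
          refine le_trans ?_ h6
          have : (A j₀ * t)^2 ≤ (A j₀)^2 := by
            rw [mul_pow]
            exact mul_le_of_le_one_right (by positivity) (by nlinarith [ht.2])
          gcongr
        simp only [hH]
        rw [Real.norm_eq_abs, abs_of_nonneg (div_nonneg (by linarith) hp.le)]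
        calc (1 - Real.cos (auxTheta A t)) / auxE A t
            ≤ (((∑ j, (A j)^3) * t^3)^2 / 2) / (t^2 * ((A j₀)^3 * (t / (1 + (A j₀)^2)))) := by
              apply div_le_div₀ (by positivity) (by linarith) (by positivity) h7
          _ = (∑ j, (A j)^3)^2 * (1 + (A j₀)^2) / (2 * (A j₀)^3) * t^3 := by
              generalize (∑ j, (A j)^3) = q
              field_simp
          _ ≤ _ := by
              apply mul_le_mul_of_nonneg_left _ (by positivity)
              exact pow_le_of_le_one ht.1.le ht.2.le (by norm_num)
      calc _ ≤ _ := norm_sub_le _ _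
        _ ≤ _ := add_le_add h1 h2
        _ = _ := by rw [hc]; ring
    · have : Filter.Tendsto (fun t : ℝ => c * t) (nhds 0) (nhds (c * 0)) :=
        (continuous_const.mul continuous_id).tendsto 0
      rw [mul_zero] at this
      exact this.mono_left nhdsWithin_le_nhds
  have hJ : 0 ≤ (∫ t in (0:ℝ)..T, auxG A t) - H T := by
    apply le_of_tendsto hlim
    filter_upwards [Ioo_mem_nhdsGT hT] with s hs
    exact hmono hs.1 hT hs.2.le
  have hHT : 0 ≤ H T := div_nonneg (by linarith [Real.cos_le_one (auxTheta A T)]) (hEpos T hT).le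
  linarith

lemma aux_core_full {m : ℕ} (A : Fin m → ℝ) (hA : ∀ j, 0 ≤ A j) (j₀ : Fin m) (hj : 0 < A j₀) :
    0 ≤ ∫ t, auxG A t := by
  have h : ∫ t, auxG A t = ∫ t, auxG A |t| := by
    congr 1
    ext t
    rcases abs_choice t with h | h
    · rw [h]
    · rw [h, auxG_neg]
  rw [h, integral_comp_abs]
  apply mul_nonneg (by norm_num)
  by_cases hi : IntegrableOn (auxG A) (Set.Ioi 0)
  · apply ge_of_tendsto (intervalIntegral_tendsto_integral_Ioi 0 hi Filter.tendsto_id)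
    filter_upwards [Filter.eventually_gt_atTop (0:ℝ)] with T hT
    exact aux_core A hA j₀ hj T hT
  · rw [integral_undef hi]

lemma aux_factor (u : ℝ) : Complex.exp (u * Complex.I) * (1 / (1 + u * Complex.I)) =
    Complex.exp (((u - Real.arctan u : ℝ) : ℂ) * Complex.I) * (((√(1 + u^2))⁻¹ : ℝ) : ℂ) := by
  have hp : 0 < √(1 + u^2) := by positivity
  have h1 : (1 + u * Complex.I : ℂ) = Complex.exp ((Real.arctan u : ℝ) * Complex.I) * (√(1+u^2) : ℝ) := by
    apply Complex.ext
    · simp only [Complex.re_mul_ofReal, Complex.exp_ofReal_mul_I_re, Real.cos_arctan]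
      simp [hp.ne']
    · simp only [Complex.im_mul_ofReal, Complex.exp_ofReal_mul_I_im, Real.sin_arctan]
      simp [hp.ne']
  rw [h1]
  push_cast
  rw [sub_mul, Complex.exp_sub]
  have := Complex.exp_ne_zero ((Real.arctan u : ℝ) * Complex.I)
  have h2 : ((√(1+u^2) : ℝ) : ℂ) ≠ 0 := by exact_mod_cast hp.ne'
  push_cast at this
  field_simp

noncomputable def auxY {m : ℕ} (A : Fin m → ℝ) (s : Fin m → ℝ) : ℝ := ∑ j, A j * (1 - s j)

lemma auxY_cont {m : ℕ} (A : Fin m → ℝ) : Continuous (auxY A) := by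
  unfold auxY; fun_prop

lemma auxY_integrable {m : ℕ} (A : Fin m → ℝ) :
    Integrable (auxY A) (Measure.pi fun _ : Fin m => expMeasure 1) := by
  have := isProbabilityMeasure_expMeasure (r := 1) one_pos
  unfold auxY
  apply integrable_finsetSum
  intro j _
  apply Integrable.const_mul
  apply (integrable_const 1).sub
  exact integrable_comp_eval (μ := fun _ : Fin m => expMeasure 1) (i := j) aux_integrable

lemma aux_sin {m : ℕ} (A : Fin m → ℝ) (t : ℝ) :
    ∫ s, Real.sin (t * auxY A s) ∂(Measure.pi fun _ : Fin m => expMeasure 1) =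
      Real.sin (auxTheta A t) / auxR A t := by
  have := isProbabilityMeasure_expMeasure (r := 1) one_pos
  have hy := (auxY_cont A)
  have hint : Integrable (fun s => Complex.exp ((t * auxY A s : ℝ) * Complex.I))
      (Measure.pi fun _ : Fin m => expMeasure 1) := by
    refine Integrable.of_bound (C := 1) ?_ (ae_of_all _ fun s => ?_)
    · apply Continuous.aestronglyMeasurable
      fun_prop
    · exact (Complex.norm_exp_ofReal_mul_I _).le
  have h : ∫ s, Complex.exp ((t * auxY A s : ℝ) * Complex.I) ∂(Measure.pi fun _ : Fin m => expMeasure 1)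
      = Complex.exp ((auxTheta A t : ℝ) * Complex.I) * (((auxR A t)⁻¹ : ℝ) : ℂ) := by
    have e : ∀ s : Fin m → ℝ, Complex.exp ((t * auxY A s : ℝ) * Complex.I) =
        ∏ j, (Complex.exp ((A j * t : ℝ) * Complex.I) *
          Complex.exp (-((A j * t : ℝ) * (s j : ℝ)) * Complex.I)) := by
      intro s
      simp_rw [← Complex.exp_add]
      rw [← Complex.exp_sum]
      congr 1
      unfold auxY
      push_cast
      rw [Finset.mul_sum, Finset.sum_mul]
      apply Finset.sum_congr rfl
      intro j _
      ring
    simp_rw [e]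
    rw [integral_fintype_prod_eq_prod (fun j (s : ℝ) => Complex.exp ((A j * t : ℝ) * Complex.I) *
          Complex.exp (-((A j * t : ℝ) * (s : ℝ)) * Complex.I))]
    simp_rw [integral_const_mul, aux_charfun, aux_factor]
    rw [Finset.prod_mul_distrib, ← Complex.exp_sum, ← Finset.sum_mul, auxTheta, auxR,
      ← Finset.prod_inv_distrib]
    push_cast
    rfl
  have h2 := congrArg Complex.im h
  rw [← Complex.imCLM_apply, ← ContinuousLinearMap.integral_comp_comm _ hint] at h2
  simp only [Complex.imCLM_apply, Complex.exp_ofReal_mul_I_im, Complex.im_mul_ofReal] at h2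
  rw [h2, div_eq_mul_inv]

noncomputable def auxK (y : ℝ) : ℝ := ∫ u in (0:ℝ)..y, Real.exp (-u^2/2)

lemma auxK_cont : Continuous auxK := by
  unfold auxK
  apply intervalIntegral.continuous_primitive
  intro a b
  apply Continuous.intervalIntegrable
  fun_prop

lemma auxK_bound (y : ℝ) : |auxK y| ≤ |y| := by
  have := intervalIntegral.norm_integral_le_of_norm_le_const (a := 0) (b := y) (C := 1)
    (f := fun u : ℝ => Real.exp (-u^2/2)) (by
      intro u _
      rw [Real.norm_eq_abs, Real.abs_exp, Real.exp_le_one_iff]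
      nlinarith [sq_nonneg u])
  simpa [auxK] using this

lemma auxK_integrable {m : ℕ} (A : Fin m → ℝ) :
    Integrable (fun s => auxK (auxY A s)) (Measure.pi fun _ : Fin m => expMeasure 1) := by
  refine (auxY_integrable A).mono ?_ (ae_of_all _ fun s => auxK_bound _)
  exact (auxK_cont.comp (auxY_cont A)).aestronglyMeasurable

lemma auxK_nonneg {m : ℕ} (A : Fin m → ℝ) (hA : ∀ j, 0 ≤ A j) (j₀ : Fin m) (hj : 0 < A j₀) :
    0 ≤ ∫ s, auxK (auxY A s) ∂(Measure.pi fun _ : Fin m => expMeasure 1) := by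
  have := isProbabilityMeasure_expMeasure (r := 1) one_pos
  have hy := auxY_cont A
  have hsinc := Real.continuous_sinc
  unfold auxK
  simp_rw [aux_K]
  rw [integral_integral_swap]
  · have h : ∀ t : ℝ, t ≠ 0 → ∫ s, auxY A s * Real.sinc (t * auxY A s)
        ∂(Measure.pi fun _ : Fin m => expMeasure 1) = Real.sin (auxTheta A t) / (t * auxR A t) := by
      intro t ht
      have e : ∀ y : ℝ, y * Real.sinc (t * y) = t⁻¹ * Real.sin (t * y) := by
        intro y
        by_cases hy : y = 0
        · simp [hy]
        rw [Real.sinc_of_ne_zero (mul_ne_zero ht hy)]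
        field_simp
      simp_rw [e]
      rw [integral_const_mul, aux_sin]
      field_simp
    have hae : (fun t : ℝ => ∫ s, auxY A s * Real.sinc (t * auxY A s)
        ∂(Measure.pi fun _ : Fin m => expMeasure 1)) =ᵐ[gaussianReal 0 1]
        fun t => Real.sin (auxTheta A t) / (t * auxR A t) := by
      have : NullSingletonClass (gaussianReal 0 1) := nullSingletonClass_gaussianReal (by norm_num)
      filter_upwards [compl_mem_ae_iff.mpr (measure_singleton (μ := gaussianReal 0 1) (0:ℝ))] with t ht
      exact h t ht
    rw [integral_congr_ae hae, integral_gaussianReal_eq_integral_smul (by norm_num)]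
    have e2 : ∀ t : ℝ, gaussianPDFReal 0 1 t • (Real.sin (auxTheta A t) / (t * auxR A t)) =
        (√(2 * Real.pi))⁻¹ * auxG A t := by
      intro t
      simp [gaussianPDFReal, auxG, mul_assoc]
    simp_rw [e2]
    rw [integral_const_mul]
    exact mul_nonneg (by positivity) (aux_core_full A hA j₀ hj)
  · have := (auxY_integrable A).comp_fst (gaussianReal 0 1)
    refine this.mono ?_ (ae_of_all _ fun p => ?_)
    · apply Continuous.aestronglyMeasurable
      simp only [Function.uncurry_def]
      fun_prop
    · simp only [Function.uncurry_def, norm_mul]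
      exact mul_le_of_le_one_right (norm_nonneg _) (Real.abs_sinc_le_one _)

lemma aux_point (b y : ℝ) (hb : 0 ≤ b) :
    gaussianQ b + (√(2 * Real.pi))⁻¹ * Real.exp (-b^2/2) * auxK y ≤
      (gaussianReal 0 1 (Set.Ici (b - y))).toReal := by
  have hI : ∀ c : ℝ, (gaussianReal 0 1 (Set.Ioi c)).toReal = ∫ u in Set.Ioi c, gaussianPDFReal 0 1 u := by
    intro c
    rw [gaussianReal_apply_eq_integral _ (by norm_num), ENNReal.toReal_ofReal]
    exact integral_nonneg fun u => gaussianPDFReal_nonneg _ _ _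
  have hn : NullSingletonClass (gaussianReal 0 1) := nullSingletonClass_gaussianReal (by norm_num)
  have hint := integrable_gaussianPDFReal 0 1
  rw [← measure_congr (Ioi_ae_eq_Ici (μ := gaussianReal 0 1)), gaussianQ, hI, hI]
  have h1 := intervalIntegral.integral_interval_add_Ioi (a := b - y) (b := b)
    hint.integrableOn hint.integrableOn
  rw [← h1, add_comm]
  gcongr
  have h2 : ∫ u in (b - y)..b, gaussianPDFReal 0 1 u =
      (√(2 * Real.pi))⁻¹ * Real.exp (-b^2/2) * ∫ v in (0:ℝ)..y, Real.exp (b * v) * Real.exp (-v^2/2) := by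
    have := intervalIntegral.integral_comp_sub_left (a := 0) (b := y)
      (fun u => gaussianPDFReal 0 1 u) b
    rw [sub_zero] at this
    rw [← this, ← intervalIntegral.integral_const_mul]
    congr 1
    ext v
    simp only [gaussianPDFReal]
    rw [← Real.exp_add, mul_assoc (√(2 * Real.pi))⁻¹, ← Real.exp_add]
    simp
    left
    ring
  rw [h2]
  apply mul_le_mul_of_nonneg_left _ (by positivity)
  unfold auxK
  rcases le_total 0 y with hy | hy
  · apply intervalIntegral.integral_mono_on hy
    · apply Continuous.intervalIntegrable; fun_prop
    · apply Continuous.intervalIntegrable; fun_prop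
    · intro v hv
      exact le_mul_of_one_le_left (Real.exp_nonneg _) (Real.one_le_exp (mul_nonneg hb hv.1))
  · rw [intervalIntegral.integral_symm y 0, intervalIntegral.integral_symm y 0, neg_le_neg_iff]
    apply intervalIntegral.integral_mono_on hy
    · apply Continuous.intervalIntegrable; fun_prop
    · apply Continuous.intervalIntegrable; fun_prop
    · intro v hv
      apply mul_le_of_le_one_left (Real.exp_nonneg _)
      rw [Real.exp_le_one_iff]
      exact mul_nonpos_of_nonneg_of_nonpos hb hv.2

theorem exp_gaussian_probability_lower_bound
    (m : ℕ) (hm : 1 ≤ m) (x : Fin m → ℝ) (hx : ∀ i, 0 ≤ x i) (hsum : ∑ i, x i = 1)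
    (a b : ℝ) (ha : 0 ≤ a) (hb : 0 < b) :
    (((Measure.pi fun _ : Fin m => expMeasure 1).prod (gaussianReal 0 1))
        {p | a * ((∑ i, x i * p.1 i) - 1) ≤ p.2 - b}).toReal ≥ gaussianQ b := by
  have hpr := isProbabilityMeasure_expMeasure (r := 1) one_pos
  set A : Fin m → ℝ := fun j => a * x j with hAdef
  have hA : ∀ j, 0 ≤ A j := fun j => mul_nonneg ha (hx j)
  have hY : ∀ s : Fin m → ℝ, auxY A s = - (a * ((∑ i, x i * s i) - 1)) := by
    intro s
    have : auxY A s = a * (∑ i, x i) - a * ∑ i, x i * s i := by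
      unfold auxY
      rw [Finset.mul_sum, Finset.mul_sum, ← Finset.sum_sub_distrib]
      apply Finset.sum_congr rfl
      intro j _
      simp only [hAdef]
      ring
    rw [this, hsum]
    ring
  have hK : 0 ≤ ∫ s, auxK (auxY A s) ∂(Measure.pi fun _ : Fin m => expMeasure 1) := by
    rcases ha.eq_or_lt with h | h
    · have : ∀ s, auxY A s = 0 := by intro s; rw [hY, ← h]; simp
      simp [this, auxK]
    · have : ∃ j, 0 < x j := by
        by_contra hcon
        push Not at hcon
        have : ∑ i, x i ≤ 0 := Finset.sum_nonpos fun i _ => hcon i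
        linarith
      obtain ⟨j, hj⟩ := this
      exact auxK_nonneg A hA j (mul_pos h hj)
  have hmeas : MeasurableSet {p : (Fin m → ℝ) × ℝ | a * ((∑ i, x i * p.1 i) - 1) ≤ p.2 - b} :=
    measurableSet_le (by fun_prop) (by fun_prop)
  have hset : ∀ s : Fin m → ℝ, Prod.mk s ⁻¹' {p : (Fin m → ℝ) × ℝ | a * ((∑ i, x i * p.1 i) - 1) ≤ p.2 - b}
      = Set.Ici (b - auxY A s) := by
    intro s
    ext z
    simp only [Set.mem_preimage, Set.mem_ofPred_eq, Set.mem_Ici, hY]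
    constructor <;> intro h <;> linarith
  have hm2 := measurable_measure_prodMk_left (ν := gaussianReal 0 1) hmeas
  rw [Measure.prod_apply hmeas, ge_iff_le,
    ← integral_toReal hm2.aemeasurable (ae_of_all _ fun s => measure_lt_top _ _)]
  simp only [hset] at hm2 ⊢
  have hi : Integrable (fun s => gaussianQ b + (√(2 * Real.pi))⁻¹ * Real.exp (-b^2/2) * auxK (auxY A s))
      (Measure.pi fun _ : Fin m => expMeasure 1) :=
    (integrable_const _).add ((auxK_integrable A).const_mul _)
  calc gaussianQ b ≤ ∫ s, (gaussianQ b + (√(2 * Real.pi))⁻¹ * Real.exp (-b^2/2) * auxK (auxY A s))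
        ∂(Measure.pi fun _ : Fin m => expMeasure 1) := by
        rw [integral_add (integrable_const _) ((auxK_integrable A).const_mul _), integral_const_mul]
        simp only [integral_const, probReal_univ, smul_eq_mul, one_mul]
        exact le_add_of_nonneg_right (mul_nonneg (by positivity) hK)
    _ ≤ _ := by
        apply integral_mono hi
        · refine Integrable.of_bound (C := 1) hm2.ennreal_toReal.aestronglyMeasurable
            (ae_of_all _ fun s => ?_)
          rw [Real.norm_eq_abs, abs_of_nonneg ENNReal.toReal_nonneg]
          exact ENNReal.toReal_le_of_le_ofReal zero_le_one (by simpa using prob_le_one)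
        · intro s
          exact aux_point b _ hb.le
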